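/- Let f : [0,∞) → ℝ be a positive function with 0 ≤ a < b, f integrable on the relevant intervals, and suppose f is m-convex for some m ∈ (0,1]. Then for every α > 0: (2/Γ(α+1)) · f(m(a+b)/2) ≤ (1/(mb−ma)^α) · J_{(ma)+}^α f(mb) + (m/(b−a)^α) · J_{b−}^α f(a), where J_{(ma)+}^α f(mb) = (1/Γ(α)) ∫_{ma}^{mb} (mb−u)^{α−1} f(u) du and J_{b−}^α f(a) = (1/Γ(α)) ∫_a^b (t−a)^{α−1} f(t) dt. -/

import Mathlib

open MeasureTheory intervalIntegral Real

/-- A nonnegative `m`-convex function is bounded above on `[0, b]`: compare with the value at `0`. -/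
lemma mConvex_le_add_of_le {m b x : ℝ} {f : ℝ → ℝ} (hm0 : 0 ≤ m)
    (hnonneg : ∀ x, 0 ≤ x → 0 ≤ f x)
    (hconv : ∀ x, 0 ≤ x → ∀ y, 0 ≤ y → ∀ t ∈ Set.Icc (0:ℝ) 1,
      f (t * x + m * (1 - t) * y) ≤ t * f x + m * (1 - t) * f y)
    (hb : 0 < b) (hx : 0 ≤ x) (hxb : x ≤ b) : f x ≤ f b + m * f 0 := by
  have ht0 : 0 ≤ x / b := by positivity
  have ht1 : x / b ≤ 1 := (div_le_one hb).2 hxb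
  have h := hconv b hb.le 0 le_rfl (x / b) ⟨ht0, ht1⟩
  rw [div_mul_cancel₀ x hb.ne', mul_zero, add_zero] at h
  have h1 : x / b * f b ≤ f b := mul_le_of_le_one_left (hnonneg b hb.le) ht1
  have h2 : 0 ≤ x / b * (m * f 0) := mul_nonneg ht0 (mul_nonneg hm0 (hnonneg 0 le_rfl))
  linarith

lemma intervalIntegrable_sub_rpow (a b : ℝ) {α : ℝ} (hα : 0 < α) :
    IntervalIntegrable (fun t => (t - a) ^ (α - 1)) volume a b := by
  have h := (intervalIntegrable_rpow' (a := 0) (b := b - a)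
    (show -1 < α - 1 by linarith)).comp_sub_right a
  simpa using h

lemma integral_sub_rpow (a b : ℝ) {α : ℝ} (hα : 0 < α) :
    ∫ t in a..b, (t - a) ^ (α - 1) = (b - a) ^ α / α := by
  rw [integral_comp_sub_right (fun t => t ^ (α - 1)) a,
    integral_rpow (Or.inl (by linarith))]
  simp [hα.ne']

/-- The Riemann–Liouville weight times a bounded integrable function is integrable. -/
lemma intervalIntegrable_sub_rpow_mul {a b α C : ℝ} {g : ℝ → ℝ} (hab : a ≤ b) (hα : 0 < α)
    (hg : IntervalIntegrable g volume a b) (hC : ∀ t ∈ Set.Icc a b, |g t| ≤ C) :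
    IntervalIntegrable (fun t => (t - a) ^ (α - 1) * g t) volume a b := by
  have hw := intervalIntegrable_sub_rpow a b hα
  rw [intervalIntegrable_iff_integrableOn_Ioc_of_le hab] at hg hw ⊢
  refine Integrable.mul_bdd (c := C) hw hg.aestronglyMeasurable ?_
  filter_upwards [ae_restrict_mem measurableSet_Ioc] with t ht
  exact hC t ⟨ht.1.le, ht.2⟩

/-- The reflection `u = m * (a + b) - m * t` carries the right-hand Riemann–Liouville integral
over `[m * a, m * b]` to a left-hand one over `[a, b]`. -/
lemma integral_sub_rpow_mul_reflect {a b m : ℝ} (α : ℝ) (f : ℝ → ℝ) (hab : a ≤ b) (hm0 : 0 < m) :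
    ∫ u in (m * a)..(m * b), (m * b - u) ^ (α - 1) * f u =
      m ^ α * ∫ t in a..b, (t - a) ^ (α - 1) * f (m * (a + b) - m * t) := by
  have h := smul_integral_comp_sub_mul (a := a) (b := b)
    (fun u => (m * b - u) ^ (α - 1) * f u) m (m * (a + b))
  rw [show m * (a + b) - m * b = m * a by ring, show m * (a + b) - m * a = m * b by ring] at h
  rw [← h, smul_eq_mul, ← intervalIntegral.integral_const_mul,
    ← intervalIntegral.integral_const_mul]
  refine integral_congr fun t ht => ?_
  rw [Set.uIcc_of_le hab] at ht
  rw [show m * b - (m * (a + b) - m * t) = m * (t - a) by ring,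
    mul_rpow hm0.le (sub_nonneg.2 ht.1), rpow_sub_one hm0.ne']
  field_simp

/-- Hermite–Hadamard type inequality (left-hand side) for `m`-convex functions via
Riemann–Liouville fractional integrals. -/
theorem mConvex_fractional_hadamard_left
    (a b m α : ℝ) (f : ℝ → ℝ)
    (ha : 0 ≤ a) (hab : a < b)
    (hpos : ∀ x, 0 ≤ x → 0 < f x)
    (hint1 : IntervalIntegrable f volume (m * a) (m * b))
    (hint2 : IntervalIntegrable f volume a b)
    (hm0 : 0 < m) (hm1 : m ≤ 1)
    (hconv : ∀ x, 0 ≤ x → ∀ y, 0 ≤ y → ∀ t ∈ Set.Icc (0:ℝ) 1,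
      f (t * x + m * (1 - t) * y) ≤ t * f x + m * (1 - t) * f y)
    (hα : 0 < α) :
    2 / Real.Gamma (α + 1) * f (m * (a + b) / 2) ≤
      1 / (m * b - m * a) ^ α *
          ((1 / Real.Gamma α) * ∫ u in (m * a)..(m * b), (m * b - u) ^ (α - 1) * f u) +
        m / (b - a) ^ α *
          ((1 / Real.Gamma α) * ∫ t in a..b, (t - a) ^ (α - 1) * f t) := by
  have hb : 0 < b := ha.trans_lt hab
  have hnonneg : ∀ x, 0 ≤ x → 0 ≤ f x := fun x hx => (hpos x hx).le
  have hbound : ∀ x, 0 ≤ x → x ≤ b → |f x| ≤ f b + m * f 0 := fun x hx hxb => by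
    rw [abs_of_nonneg (hnonneg x hx)]
    exact mConvex_le_add_of_le hm0.le hnonneg hconv hb hx hxb
  have hrefl : ∀ t ∈ Set.Icc a b, 0 ≤ m * (a + b) - m * t ∧ m * (a + b) - m * t ≤ b :=
    fun t ht => by
      have h1 : 0 ≤ m * (a + b - t) := mul_nonneg hm0.le (by linarith [ht.2])
      have h2 : m * (a + b - t) ≤ 1 * b :=
        mul_le_mul hm1 (by linarith [ht.1]) (by linarith [ht.2]) zero_le_one
      constructor <;> linarith
  have hg : IntervalIntegrable (fun t => f (m * (a + b) - m * t)) volume a b := by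
    have h := ((hint1.comp_sub_left (m * (a + b))).comp_mul_left (c := m)).symm
    rwa [show (m * (a + b) - m * b) / m = a by field_simp; ring,
      show (m * (a + b) - m * a) / m = b by field_simp; ring] at h
  have hw := intervalIntegrable_sub_rpow a b hα
  have hI1 := intervalIntegrable_sub_rpow_mul hab.le hα hg
    fun t ht => hbound _ (hrefl t ht).1 (hrefl t ht).2
  have hI2 := intervalIntegrable_sub_rpow_mul hab.le hα hint2
    fun t ht => hbound t (ha.trans ht.1) ht.2
  have hpoint : ∀ t ∈ Set.Icc a b, (t - a) ^ (α - 1) * (2 * f (m * (a + b) / 2)) ≤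
      (t - a) ^ (α - 1) * f (m * (a + b) - m * t) + m * ((t - a) ^ (α - 1) * f t) := by
    intro t ht
    have h := hconv _ (hrefl t ht).1 t (ha.trans ht.1) (1 / 2) ⟨by norm_num, by norm_num⟩
    rw [show 1 / 2 * (m * (a + b) - m * t) + m * (1 - 1 / 2) * t = m * (a + b) / 2 by ring] at h
    have hmul := mul_le_mul_of_nonneg_left (show 2 * f (m * (a + b) / 2) ≤
      f (m * (a + b) - m * t) + m * f t by linarith) (rpow_nonneg (sub_nonneg.2 ht.1) (α - 1))
    linarith
  have key := integral_mono_on hab.le (hw.mul_const _) (hI1.add (hI2.const_mul m)) hpoint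
  rw [integral_add hI1 (hI2.const_mul m), intervalIntegral.integral_mul_const,
    intervalIntegral.integral_const_mul, integral_sub_rpow a b hα] at key
  rw [integral_sub_rpow_mul_reflect α f hab.le hm0, ← mul_sub,
    mul_rpow hm0.le (sub_nonneg.2 hab.le), Gamma_add_one hα.ne']
  have hΓ := Gamma_pos_of_pos hα
  have hba : 0 < (b - a) ^ α := rpow_pos_of_pos (sub_pos.2 hab) α
  have hmα : 0 < m ^ α := rpow_pos_of_pos hm0 α
  generalize (∫ t in a..b, (t - a) ^ (α - 1) * f (m * (a + b) - m * t)) = A at *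
  generalize (∫ t in a..b, (t - a) ^ (α - 1) * f t) = B at *
  calc 2 / (α * Gamma α) * f (m * (a + b) / 2)
      = ((b - a) ^ α / α * (2 * f (m * (a + b) / 2))) / ((b - a) ^ α * Gamma α) := by
        field_simp
    _ ≤ (A + m * B) / ((b - a) ^ α * Gamma α) := by gcongr
    _ = 1 / (m ^ α * (b - a) ^ α) * (1 / Gamma α * (m ^ α * A)) +
        m / (b - a) ^ α * (1 / Gamma α * B) := by
        field_simp
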